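/- (Convergence of randomized Kaczmarz.) Let A be a nonzero real m×n matrix each of whose rows A_{i,:} is nonzero, let b ∈ ℝᵐ with b ∈ range(A) (so Ax = b is consistent), let x⁰ ∈ ℝⁿ be arbitrary, and let x* be the unique vector with Ax* = b and x⁰ − x* ∈ range(Aᵀ). Then for every k ≥ 1, E[‖x^k − x*‖₂²] := Σ_{(i₁,…,i_k)∈[m]^k} (∏_{t=1}^{k} ‖A_{i_t,:}‖₂²/‖A‖_F²) · ‖x^k_{(i₁,…,i_k)} − x*‖₂² ≤ ρ^k ‖x⁰ − x*‖₂², where x^k_{(i₁,…,i_k)} is obtained from x⁰ by the updates x^t = x^{t−1} − ((A_{i_t,:}x^{t−1} − b_{i_t})/‖A_{i_t,:}‖₂²)(A_{i_t,:})ᵀ for t = 1,…,k. -/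

import Mathlib

open Matrix

/-- Squared Euclidean norm. -/
def sqnorm {n : ℕ} (u : Fin n → ℝ) : ℝ := ∑ i, (u i) ^ 2

/-- Squared Frobenius norm of a matrix. -/
def frob2 {m n : ℕ} (A : Matrix (Fin m) (Fin n) ℝ) : ℝ := ∑ i, ∑ j, (A i j) ^ 2

/-- Squared Euclidean norm of the `i`-th row of `A`. -/
def rowNorm2 {m n : ℕ} (A : Matrix (Fin m) (Fin n) ℝ) (i : Fin m) : ℝ := ∑ j, (A i j) ^ 2

/-- One Kaczmarz step for the system `Ax = b`, using row `i`. -/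
noncomputable def kacStep {m n : ℕ} (A : Matrix (Fin m) (Fin n) ℝ) (b : Fin m → ℝ) (i : Fin m)
    (x : Fin n → ℝ) : Fin n → ℝ :=
  x - ((A.mulVec x i - b i) / rowNorm2 A i) • (fun j => A i j)

/-- `μ` is the smallest nonzero (real) eigenvalue of the matrix `M`. -/
def IsSmallestNonzeroEigenvalue {n : ℕ} (M : Matrix (Fin n) (Fin n) ℝ) (μ : ℝ) : Prop :=
  μ ≠ 0 ∧ (∃ v : Fin n → ℝ, v ≠ 0 ∧ M.mulVec v = μ • v) ∧
    ∀ t : ℝ, t ≠ 0 → (∃ v : Fin n → ℝ, v ≠ 0 ∧ M.mulVec v = t • v) → μ ≤ t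

theorem sqnorm_eq_dotProduct {n : ℕ} (u : Fin n → ℝ) : sqnorm u = u ⬝ᵥ u := by
  simp [sqnorm, dotProduct, sq]

theorem sqnorm_nonneg {n : ℕ} (u : Fin n → ℝ) : 0 ≤ sqnorm u :=
  Finset.sum_nonneg fun i _ => sq_nonneg (u i)

theorem rowNorm2_pos {m n : ℕ} {A : Matrix (Fin m) (Fin n) ℝ} {i : Fin m}
    (h : (fun j => A i j) ≠ 0) : 0 < rowNorm2 A i := by
  obtain ⟨j, hj⟩ := Function.ne_iff.mp h
  exact Finset.sum_pos' (fun j _ => sq_nonneg _) ⟨j, Finset.mem_univ _, sq_pos_of_ne_zero hj⟩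

theorem frob2_pos {m n : ℕ} {A : Matrix (Fin m) (Fin n) ℝ} (hA : A ≠ 0) : 0 < frob2 A := by
  obtain ⟨i, hi⟩ := Function.ne_iff.mp hA
  exact Finset.sum_pos' (fun i _ => Finset.sum_nonneg fun j _ => sq_nonneg _)
    ⟨i, Finset.mem_univ _, rowNorm2_pos hi⟩

/-- On the row space of `A`, the smallest nonzero eigenvalue of `AᵀA` bounds the Rayleigh quotient
from below. -/
theorem mul_sqnorm_le_sqnorm_mulVec {m n : ℕ} {A : Matrix (Fin m) (Fin n) ℝ} {μ : ℝ}
    (hμ : IsSmallestNonzeroEigenvalue (Aᵀ * A) μ) {e : Fin n → ℝ}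
    (he : e ∈ Set.range (Aᵀ.mulVec)) : μ * sqnorm e ≤ sqnorm (A *ᵥ e) := by
  obtain ⟨y, rfl⟩ := he
  have hM : (Aᵀ * A).IsHermitian := by
    simpa [conjTranspose_eq_transpose_of_trivial] using isHermitian_conjTranspose_mul_self A
  have hsum (u w : Fin n → ℝ) :
      ∑ i, (u ⬝ᵥ ⇑(hM.eigenvectorBasis i)) * (w ⬝ᵥ ⇑(hM.eigenvectorBasis i)) = u ⬝ᵥ w := by
    have := hM.eigenvectorBasis.sum_inner_mul_inner (WithLp.toLp 2 u) (WithLp.toLp 2 w)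
    simp only [EuclideanSpace.inner_eq_star_dotProduct, star_trivial] at this
    rw [dotProduct_comm u w, ← this]
    exact Finset.sum_congr rfl fun i _ => by rw [dotProduct_comm u]
  have hadj (u w : Fin n → ℝ) : (A *ᵥ u) ⬝ᵥ (A *ᵥ w) = u ⬝ᵥ ((Aᵀ * A) *ᵥ w) := by
    rw [← mulVec_mulVec, dotProduct_mulVec u, vecMul_transpose]
  have hMe (i : Fin n) : ((Aᵀ * A) *ᵥ (Aᵀ *ᵥ y)) ⬝ᵥ ⇑(hM.eigenvectorBasis i) =
      hM.eigenvalues i * ((Aᵀ *ᵥ y) ⬝ᵥ ⇑(hM.eigenvectorBasis i)) := by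
    rw [dotProduct_comm, ← hadj, dotProduct_comm, hadj, hM.mulVec_eigenvectorBasis,
      dotProduct_smul, smul_eq_mul]
  rw [sqnorm_eq_dotProduct, sqnorm_eq_dotProduct, hadj, ← hsum, ← hsum, Finset.mul_sum]
  refine Finset.sum_le_sum fun i _ => ?_
  rw [hMe]
  set c := (Aᵀ *ᵥ y) ⬝ᵥ ⇑(hM.eigenvectorBasis i) with hc
  have heig := hM.mulVec_eigenvectorBasis i
  by_cases h0 : hM.eigenvalues i = 0
  · have hA0 : A *ᵥ ⇑(hM.eigenvectorBasis i) = 0 := by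
      rw [← dotProduct_self_eq_zero, hadj, heig, h0, zero_smul, dotProduct_zero]
    have : c = 0 := by
      rw [hc, dotProduct_comm, dotProduct_mulVec, vecMul_transpose, hA0, zero_dotProduct]
    simp [this]
  · have hle : μ ≤ hM.eigenvalues i := by
      refine hμ.2.2 _ h0 ⟨_, fun hv => ?_, heig⟩
      exact hM.eigenvectorBasis.orthonormal.ne_zero i (by ext j; exact congrFun hv j)
    nlinarith [mul_le_mul_of_nonneg_right hle (mul_self_nonneg c)]

theorem kacStep_sub {m n : ℕ} (A : Matrix (Fin m) (Fin n) ℝ) (xs x : Fin n → ℝ) (i : Fin m) :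
    kacStep A (A *ᵥ xs) i x - xs =
      (x - xs) - ((A *ᵥ (x - xs)) i / rowNorm2 A i) • (fun j => A i j) := by
  rw [kacStep, mulVec_sub, Pi.sub_apply, sub_right_comm]

theorem kacStep_sub_mem_range {m n : ℕ} {A : Matrix (Fin m) (Fin n) ℝ} {xs x : Fin n → ℝ}
    (hx : x - xs ∈ Set.range (Aᵀ.mulVec)) (i : Fin m) :
    kacStep A (A *ᵥ xs) i x - xs ∈ Set.range (Aᵀ.mulVec) := by
  obtain ⟨y, hy⟩ := hx
  refine ⟨y - ((A *ᵥ (x - xs)) i / rowNorm2 A i) • Pi.single i 1, ?_⟩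
  rw [kacStep_sub, ← hy, mulVec_sub, mulVec_smul, mulVec_single_one]
  rfl

theorem sqnorm_kacStep_sub {m n : ℕ} {A : Matrix (Fin m) (Fin n) ℝ} (xs x : Fin n → ℝ) {i : Fin m}
    (hi : rowNorm2 A i ≠ 0) :
    sqnorm (kacStep A (A *ᵥ xs) i x - xs) =
      sqnorm (x - xs) - (A *ᵥ (x - xs)) i ^ 2 / rowNorm2 A i := by
  have hr : (fun j => A i j) ⬝ᵥ (fun j => A i j) = rowNorm2 A i :=
    (sqnorm_eq_dotProduct _).symm
  have hd : (fun j => A i j) ⬝ᵥ (x - xs) = (A *ᵥ (x - xs)) i := rfl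
  rw [kacStep_sub, sqnorm_eq_dotProduct, sqnorm_eq_dotProduct]
  simp only [sub_dotProduct (x - xs), dotProduct_sub _ (x - xs), smul_dotProduct, dotProduct_smul,
    smul_eq_mul, dotProduct_comm (x - xs) (fun j => A i j), hr, hd]
  field_simp
  ring

/-- A single randomized Kaczmarz step contracts the expected squared error. -/
theorem sum_sqnorm_kacStep_sub_le {m n : ℕ} {A : Matrix (Fin m) (Fin n) ℝ} (hA : A ≠ 0)
    (hrows : ∀ i, (fun j => A i j) ≠ 0) {μ : ℝ} (hμ : IsSmallestNonzeroEigenvalue (Aᵀ * A) μ)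
    {xs x : Fin n → ℝ} (hx : x - xs ∈ Set.range (Aᵀ.mulVec)) :
    ∑ i, rowNorm2 A i / frob2 A * sqnorm (kacStep A (A *ᵥ xs) i x - xs) ≤
      (1 - μ / frob2 A) * sqnorm (x - xs) := by
  have hF := frob2_pos hA
  have hterm (i : Fin m) : rowNorm2 A i / frob2 A * sqnorm (kacStep A (A *ᵥ xs) i x - xs) =
      (rowNorm2 A i * sqnorm (x - xs) - (A *ᵥ (x - xs)) i ^ 2) / frob2 A := by
    have hi := (rowNorm2_pos (hrows i)).ne'
    rw [sqnorm_kacStep_sub xs x hi]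
    field_simp
  have hsum : ∑ i, rowNorm2 A i = frob2 A := rfl
  have hsq : ∑ i, (A *ᵥ (x - xs)) i ^ 2 = sqnorm (A *ᵥ (x - xs)) := rfl
  simp only [hterm]
  rw [← Finset.sum_div, Finset.sum_sub_distrib, ← Finset.sum_mul, hsum, hsq, div_le_iff₀ hF]
  have hle := mul_sqnorm_le_sqnorm_mulVec hμ hx
  have heq : (1 - μ / frob2 A) * sqnorm (x - xs) * frob2 A =
      frob2 A * sqnorm (x - xs) - μ * sqnorm (x - xs) := by
    field_simp
  linarith

theorem one_sub_div_frob2_nonneg {m n : ℕ} {A : Matrix (Fin m) (Fin n) ℝ} (hA : A ≠ 0)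
    (hrows : ∀ i, (fun j => A i j) ≠ 0) {μ : ℝ} (hμ : IsSmallestNonzeroEigenvalue (Aᵀ * A) μ) :
    0 ≤ 1 - μ / frob2 A := by
  obtain ⟨i, -⟩ := Function.ne_iff.mp hA
  have hmem : (fun j => A i j) - 0 ∈ Set.range (Aᵀ.mulVec) :=
    ⟨Pi.single i 1, by rw [mulVec_single_one, sub_zero]; rfl⟩
  have hstep := sum_sqnorm_kacStep_sub_le hA hrows hμ hmem
  have hpos : 0 < sqnorm ((fun j => A i j) - 0) := by
    rw [sub_zero]
    exact rowNorm2_pos (hrows i)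
  refine nonneg_of_mul_nonneg_left (le_trans ?_ hstep) hpos
  exact Finset.sum_nonneg fun i _ => mul_nonneg
    (div_nonneg (rowNorm2_pos (hrows i)).le (frob2_pos hA).le) (sqnorm_nonneg _)

/-- Convergence of randomized Kaczmarz: for consistent `Ax = b`,
`E[‖x^k − x*‖₂²] ≤ ρ^k ‖x⁰ − x*‖₂²` where `ρ = 1 − μ/‖A‖_F²` and the expectation is over
index sequences `(i₁,…,i_k)` drawn with probabilities `‖A_{i,:}‖₂²/‖A‖_F²`. -/
theorem stmt6 {m n : ℕ} (A : Matrix (Fin m) (Fin n) ℝ) (hA : A ≠ 0)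
    (hrows : ∀ i, (fun j => A i j) ≠ 0)
    (μ : ℝ) (hμ : IsSmallestNonzeroEigenvalue (Aᵀ * A) μ)
    (b : Fin m → ℝ) (hb : b ∈ Set.range A.mulVec)
    (x0 xs : Fin n → ℝ) (hxs : A.mulVec xs = b) (hx0 : x0 - xs ∈ Set.range (Aᵀ.mulVec))
    (k : ℕ) (hk : 1 ≤ k) :
    ∑ s : Fin k → Fin m,
        (∏ t, rowNorm2 A (s t) / frob2 A) *
          sqnorm ((List.ofFn s).foldl (fun x i => kacStep A b i x) x0 - xs)
      ≤ (1 - μ / frob2 A) ^ k * sqnorm (x0 - xs) := by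
  subst hxs
  clear hk hb
  induction k generalizing x0 with
  | zero => simp
  | succ k ih =>
    rw [← (Fin.consEquiv fun _ => Fin m).sum_comp, Fintype.sum_prod_type]
    simp only [Fin.consEquiv_apply, Fin.prod_univ_succ, List.ofFn_succ, Fin.cons_zero,
      Fin.cons_succ, List.foldl_cons, mul_assoc, ← Finset.mul_sum]
    calc _ ≤ ∑ i, rowNorm2 A i / frob2 A *
          ((1 - μ / frob2 A) ^ k * sqnorm (kacStep A (A *ᵥ xs) i x0 - xs)) :=
          Finset.sum_le_sum fun i _ => mul_le_mul_of_nonneg_left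
            (ih _ (kacStep_sub_mem_range hx0 i))
            (div_nonneg (rowNorm2_pos (hrows i)).le (frob2_pos hA).le)
      _ = (1 - μ / frob2 A) ^ k *
          ∑ i, rowNorm2 A i / frob2 A * sqnorm (kacStep A (A *ᵥ xs) i x0 - xs) := by
          rw [Finset.mul_sum]
          exact Finset.sum_congr rfl fun i _ => mul_left_comm _ _ _
      _ ≤ (1 - μ / frob2 A) ^ k * ((1 - μ / frob2 A) * sqnorm (x0 - xs)) :=
          mul_le_mul_of_nonneg_left (sum_sqnorm_kacStep_sub_le hA hrows hμ hx0)
            (pow_nonneg (one_sub_div_frob2_nonneg hA hrows hμ) k)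
      _ = _ := by rw [pow_succ, mul_assoc]
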